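/- Let n ≥ 2 and let F : ℝ^{n+1} → ℝ^{n+1} be a smooth diffeomorphism with components y_1, …, y_{n+1}. Then F is a causal automorphism of (n+1)-dimensional Minkowski spacetime if and only if ∂y_{n+1}/∂x_{n+1} ≥ 0 at every point and, for every smooth function ψ : ℝ^{n+1} → ℝ, □(ψ∘F) = 0 on ℝ^{n+1} if and only if □ψ = 0 on ℝ^{n+1}. -/

import Mathlib

open scoped BigOperators
open Matrix

noncomputable section

/-- Sign vector of the Minkowski metric: `+1` for the first `n` coordinates, `-1` for the last. -/
def eps (n : ℕ) (i : Fin (n + 1)) : ℝ := if i = Fin.last n then -1 else 1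

/-- The Minkowski bilinear form `η(u,v) = Σ_{i<n} u_i v_i − u_n v_n` on `ℝ^{n+1}`. -/
def eta (n : ℕ) (u v : Fin (n + 1) → ℝ) : ℝ := ∑ i, eps n i * u i * v i

/-- Partial derivative in the `i`-th coordinate direction. -/
def pd (n : ℕ) (f : (Fin (n + 1) → ℝ) → ℝ) (i : Fin (n + 1)) (x : Fin (n + 1) → ℝ) : ℝ :=
  fderiv ℝ f x (Pi.single i 1)

/-- The wave operator `□φ = Σ_{i=1}^n ∂²φ/∂x_i² − ∂²φ/∂x_{n+1}²`. -/
def waveOp (n : ℕ) (f : (Fin (n + 1) → ℝ) → ℝ) (x : Fin (n + 1) → ℝ) : ℝ :=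
  ∑ i, eps n i * pd n (pd n f i) i x

/-- The causal order on Minkowski space: `x ≤ y` iff `y − x` is causal and future-pointing. -/
def causalLe (n : ℕ) (x y : Fin (n + 1) → ℝ) : Prop :=
  eta n (y - x) (y - x) ≤ 0 ∧ x (Fin.last n) ≤ y (Fin.last n)

/-- A causal automorphism: a bijection preserving the causal order in both directions. -/
def IsCausalAuto (n : ℕ) (F : (Fin (n + 1) → ℝ) → (Fin (n + 1) → ℝ)) : Prop :=
  Function.Bijective F ∧ ∀ x y, causalLe n x y ↔ causalLe n (F x) (F y)

/-- The matrix `η = diag(1, …, 1, −1)`. -/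
def etaM (n : ℕ) : Matrix (Fin (n + 1)) (Fin (n + 1)) ℝ := Matrix.diagonal (eps n)

/-- A Lorentz matrix: `Aᵀ η A = η`. -/
def IsLorentz (n : ℕ) (A : Matrix (Fin (n + 1)) (Fin (n + 1)) ℝ) : Prop :=
  Aᵀ * etaM n * A = etaM n

/-- The `i`-th row of the Jacobian of `F` at `x`. -/
def jacRow (n : ℕ) (F : (Fin (n + 1) → ℝ) → (Fin (n + 1) → ℝ)) (i : Fin (n + 1))
    (x : Fin (n + 1) → ℝ) : Fin (n + 1) → ℝ :=
  fun j => pd n (fun z => F z i) j x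

section

variable {n : ℕ}

lemma eta_eq (u v : Fin (n + 1) → ℝ) :
    eta n u v = ∑ i : Fin n, u i.castSucc * v i.castSucc - u (Fin.last n) * v (Fin.last n) := by
  simp [eta, eps, Fin.sum_univ_castSucc, Fin.castSucc_ne_last]
  ring

lemma eta_eq_dotProduct (u v : Fin (n + 1) → ℝ) : eta n u v = u ⬝ᵥ (etaM n) *ᵥ v := by
  simp only [eta, etaM, dotProduct, mulVec_diagonal]
  exact Finset.sum_congr rfl fun i _ => by ring

lemma eta_comm (u v : Fin (n + 1) → ℝ) : eta n u v = eta n v u := by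
  simp only [eta]
  exact Finset.sum_congr rfl fun i _ => by ring

lemma eta_add_left (u v w : Fin (n + 1) → ℝ) : eta n (u + v) w = eta n u w + eta n v w := by
  simp [eta_eq_dotProduct]

lemma eta_smul_left (c : ℝ) (u v : Fin (n + 1) → ℝ) : eta n (c • u) v = c * eta n u v := by
  simp [eta_eq_dotProduct]

lemma eta_add_right (u v w : Fin (n + 1) → ℝ) : eta n u (v + w) = eta n u v + eta n u w := by
  simp [eta_eq_dotProduct, mulVec_add]

lemma eta_smul_right (c : ℝ) (u v : Fin (n + 1) → ℝ) : eta n u (c • v) = c * eta n u v := by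
  simp [eta_eq_dotProduct, mulVec_smul]

lemma eta_sub_left (u v w : Fin (n + 1) → ℝ) : eta n (u - v) w = eta n u w - eta n v w := by
  simp [eta_eq_dotProduct, sub_dotProduct]

lemma eta_sub_right (u v w : Fin (n + 1) → ℝ) : eta n u (v - w) = eta n u v - eta n u w := by
  simp [eta_eq_dotProduct, mulVec_sub]

lemma eta_neg_neg (u v : Fin (n + 1) → ℝ) : eta n (-u) (-v) = eta n u v := by
  simp [eta]

/-- The Minkowski form as a continuous bilinear map. -/
def etaCLM (n : ℕ) : (Fin (n + 1) → ℝ) →L[ℝ] (Fin (n + 1) → ℝ) →L[ℝ] ℝ :=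
  LinearMap.toContinuousBilinearMap
    (LinearMap.mk₂ ℝ (eta n) eta_add_left eta_smul_left eta_add_right eta_smul_right)

@[simp] lemma etaCLM_apply (u v : Fin (n + 1) → ℝ) : etaCLM n u v = eta n u v := rfl

lemma eps_last : eps n (Fin.last n) = -1 := by simp [eps]

lemma eps_of_ne {i : Fin (n + 1)} (h : i ≠ Fin.last n) : eps n i = 1 := by simp [eps, h]

lemma eps_mul_self (i : Fin (n + 1)) : eps n i * eps n i = 1 := by
  by_cases h : i = Fin.last n <;> simp [eps, h]

lemma eta_single_single (i j : Fin (n + 1)) :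
    eta n (Pi.single i 1) (Pi.single j 1) = if i = j then eps n i else 0 := by
  by_cases h : i = j
  · subst h; simp [eta, Pi.single_apply]
  · simp [eta, Pi.single_apply, h, Ne.symm h]

/-- Minkowski products of standard basis vectors form the matrix `etaM`. -/
lemma etaM_apply (i j : Fin (n + 1)) : etaM n i j = if i = j then eps n i else 0 := by
  simp [etaM, diagonal_apply]

lemma etaM_mul_self : etaM n * etaM n = 1 := by
  simp [etaM, diagonal_mul_diagonal, eps_mul_self]

lemma eta_self_nonneg_of_last_eq_zero {u : Fin (n + 1) → ℝ} (h : u (Fin.last n) = 0) :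
    0 ≤ eta n u u := by
  rw [eta_eq, h]
  simpa using Finset.sum_nonneg fun i _ => mul_self_nonneg (u (Fin.castSucc i))

/-- A causal vector with vanishing time component is zero. -/
lemma eq_zero_of_eta_self_nonpos {u : Fin (n + 1) → ℝ} (hu : eta n u u ≤ 0)
    (h : u (Fin.last n) = 0) : u = 0 := by
  rw [eta_eq, h] at hu
  have h0 : ∑ i : Fin n, u i.castSucc * u i.castSucc = 0 :=
    le_antisymm (by linarith) (Finset.sum_nonneg fun i _ => mul_self_nonneg _)
  rw [Finset.sum_eq_zero_iff_of_nonneg fun i _ => mul_self_nonneg _] at h0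
  funext i
  induction i using Fin.lastCases with
  | last => exact h
  | cast i => simpa using h0 i (Finset.mem_univ i)

/-- Orthogonal null vectors are parallel. -/
lemma exists_smul_of_null {a b : Fin (n + 1) → ℝ} (ha : eta n a a = 0) (hb : eta n b b = 0)
    (hab : eta n a b = 0) (ha0 : a ≠ 0) : ∃ r : ℝ, b = r • a := by
  have hl : a (Fin.last n) ≠ 0 := fun h => ha0 (eq_zero_of_eta_self_nonpos ha.le h)
  refine ⟨b (Fin.last n) / a (Fin.last n), sub_eq_zero.mp (eq_zero_of_eta_self_nonpos ?_ ?_)⟩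
  · simp [eta_sub_left, eta_sub_right, eta_smul_left, eta_smul_right, ha, hb, hab,
      eta_comm b a]
  · simp [hl]

/-- A symmetric matrix whose quadratic form vanishes on null vectors is a multiple of `etaM`. -/
lemma eq_smul_etaM {M : Matrix (Fin (n + 1)) (Fin (n + 1)) ℝ} (hM : Mᵀ = M)
    (h : ∀ v, eta n v v = 0 → v ⬝ᵥ M *ᵥ v = 0) :
    M = (-M (Fin.last n) (Fin.last n)) • etaM n := by
  have hs : ∀ i j, M i j = M j i := fun i j => congrFun (congrFun hM j) i
  have h2 : ∀ i, i ≠ Fin.last n → ∀ s : ℝ, s * s = 1 →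
      M i i + 2 * s * M i (Fin.last n) + M (Fin.last n) (Fin.last n) = 0 := by
    intro i hi s hss
    have := h (Pi.single i 1 + s • Pi.single (Fin.last n) 1) (by
      simp only [eta_add_left, eta_add_right, eta_smul_left, eta_smul_right, eta_single_single,
        if_neg hi, if_neg hi.symm, eps_last, eps_of_ne hi, if_true]
      linarith)
    simp only [mulVec_add, mulVec_smul, dotProduct_add, add_dotProduct, smul_dotProduct,
      dotProduct_smul, mulVec_single_one, single_one_dotProduct, col_apply, smul_eq_mul,
      hs (Fin.last n) i] at this
    linear_combination this + (- M (Fin.last n) (Fin.last n)) * hss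
  have hil : ∀ i, i ≠ Fin.last n → M i (Fin.last n) = 0 := fun i hi => by
    linarith [h2 i hi 1 (by norm_num), h2 i hi (-1) (by norm_num)]
  have hii : ∀ i, i ≠ Fin.last n → M i i = - M (Fin.last n) (Fin.last n) := fun i hi => by
    linarith [h2 i hi 1 (by norm_num), h2 i hi (-1) (by norm_num)]
  have hij : ∀ i j, i ≠ Fin.last n → j ≠ Fin.last n → i ≠ j → M i j = 0 := by
    intro i j hi hj hne
    have := h ((3 : ℝ) • Pi.single i 1 + (4 : ℝ) • Pi.single j 1
        + (5 : ℝ) • Pi.single (Fin.last n) 1) (by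
      simp only [eta_add_left, eta_add_right, eta_smul_left, eta_smul_right, eta_single_single,
        if_neg hi, if_neg hi.symm, if_neg hj, if_neg hj.symm, if_neg hne, if_neg hne.symm,
        eps_last, eps_of_ne hi, eps_of_ne hj, if_true]
      norm_num)
    simp only [mulVec_add, mulVec_smul, dotProduct_add, add_dotProduct, smul_dotProduct,
      dotProduct_smul, mulVec_single_one, single_one_dotProduct, col_apply, smul_eq_mul,
      hs (Fin.last n) i, hs (Fin.last n) j, hil i hi, hil j hj, hii i hi, hii j hj,
      hs j i] at this
    linarith
  ext i j
  rw [Matrix.smul_apply, etaM_apply, smul_eq_mul]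
  by_cases hi : i = Fin.last n <;> by_cases hj : j = Fin.last n
  · subst hi; subst hj; simp [eps_last]
  · subst hi; rw [hs, hil j hj, if_neg (Ne.symm hj)]; simp
  · subst hj; rw [hil i hi, if_neg hi]; simp
  · by_cases hne : i = j
    · subst hne; simp [hii i hi, eps_of_ne hi]
    · simp [hij i j hi hj hne, hne]

/-- If `J` scales the Minkowski metric, then so does its transpose. -/
lemma mul_etaM_mul_transpose {J : Matrix (Fin (n + 1)) (Fin (n + 1)) ℝ} {c : ℝ} (hc : c ≠ 0)
    (h : Jᵀ * etaM n * J = c • etaM n) : J * etaM n * Jᵀ = c • etaM n := by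
  have h1 : (c⁻¹ • (etaM n * Jᵀ * etaM n)) * J = 1 := by
    rw [Matrix.smul_mul, Matrix.mul_assoc (etaM n), Matrix.mul_assoc (etaM n), h,
      Matrix.mul_smul, etaM_mul_self, smul_smul, inv_mul_cancel₀ hc, one_smul]
  have h2 := mul_eq_one_comm.mp h1
  calc J * etaM n * Jᵀ = c • (J * (c⁻¹ • (etaM n * Jᵀ * etaM n)) * etaM n) := by
        rw [Matrix.mul_smul, Matrix.smul_mul, smul_smul, mul_inv_cancel₀ hc, one_smul]
        simp only [Matrix.mul_assoc, etaM_mul_self, Matrix.mul_one]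
    _ = c • etaM n := by rw [h2, Matrix.one_mul]

/-- The Minkowski trace of the pullback of a bilinear form under `J`. -/
lemma sum_eps_apply_mulVec (J : Matrix (Fin (n + 1)) (Fin (n + 1)) ℝ)
    (B : (Fin (n + 1) → ℝ) →L[ℝ] (Fin (n + 1) → ℝ) →L[ℝ] ℝ) :
    ∑ i, eps n i * B (J.col i) (J.col i)
      = ∑ a, ∑ b, (J * etaM n * Jᵀ) a b * B (Pi.single a 1) (Pi.single b 1) := by
  have hB : ∀ u v, B u v = ∑ a, ∑ b, u a * v b * B (Pi.single a 1) (Pi.single b 1) := by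
    intro u v
    conv_lhs => rw [pi_eq_sum_univ' u, pi_eq_sum_univ' v]
    simp only [map_sum, map_smul, _root_.sum_apply, _root_.smul_apply, smul_eq_mul,
      Finset.mul_sum]
    rw [Finset.sum_comm]
    exact Finset.sum_congr rfl fun a _ => Finset.sum_congr rfl fun b _ => by ring
  simp_rw [fun i => hB (J.col i) (J.col i), Finset.mul_sum]
  rw [Finset.sum_comm]
  refine Finset.sum_congr rfl fun a _ => ?_
  rw [Finset.sum_comm]
  refine Finset.sum_congr rfl fun b _ => ?_
  rw [etaM, mul_apply, Finset.sum_mul]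
  refine Finset.sum_congr rfl fun i _ => ?_
  rw [mul_diagonal, transpose_apply, col_apply, col_apply]
  ring

/-- A future timelike covector is positive on future causal vectors. -/
lemma dotProduct_pos {r v : Fin (n + 1) → ℝ} (hr : eta n r r < 0) (hr0 : 0 ≤ r (Fin.last n))
    (hv : eta n v v ≤ 0) (hv0 : 0 < v (Fin.last n)) : 0 < r ⬝ᵥ v := by
  rw [eta_eq] at hr hv
  have hcs := Finset.sum_mul_sq_le_sq_mul_sq Finset.univ
    (fun i : Fin n => r i.castSucc) (fun i => v i.castSucc)
  simp only [dotProduct, Fin.sum_univ_castSucc]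
  simp only [← sq] at hr hv
  set S := ∑ i : Fin n, r i.castSucc * v i.castSucc
  have hlt : S ^ 2 < (r (Fin.last n) * v (Fin.last n)) ^ 2 := by
    have h1 : (0 : ℝ) ≤ ∑ i : Fin n, r i.castSucc ^ 2 := Finset.sum_nonneg fun i _ => sq_nonneg _
    rw [mul_pow]
    have hv2 : 0 < v (Fin.last n) ^ 2 := by positivity
    refine hcs.trans_lt ?_
    calc _ ≤ (∑ i : Fin n, r i.castSucc ^ 2) * v (Fin.last n) ^ 2 :=
          mul_le_mul_of_nonneg_left (by linarith) h1
      _ < _ := mul_lt_mul_of_pos_right (by linarith) hv2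
  have := abs_lt_of_sq_lt_sq' hlt (mul_nonneg hr0 hv0.le)
  linarith [this.1]

lemma causalLe_iff (x y : Fin (n + 1) → ℝ) : causalLe n x y ↔
    eta n (y - x) (y - x) ≤ 0 ∧ 0 ≤ (y - x) (Fin.last n) := by
  simp [causalLe]

/-- A continuous causally monotone map with causally monotone inverse preserves null separation. -/
lemma eta_map_sub_eq_zero_of_causalLe {F : (Fin (n + 1) → ℝ) → (Fin (n + 1) → ℝ)}
    (hF : Continuous F) (hc : ∀ x y, causalLe n x y ↔ causalLe n (F x) (F y))
    {x y : Fin (n + 1) → ℝ} (hxy : causalLe n x y) (h : eta n (y - x) (y - x) = 0) :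
    eta n (F y - F x) (F y - F x) = 0 := by
  have hle := (causalLe_iff _ _).mp ((hc x y).mp hxy)
  refine le_antisymm hle.1 (not_lt.mp fun hlt => ?_)
  have hpos : 0 < (F y - F x) (Fin.last n) := lt_of_le_of_ne hle.2 fun h0 =>
    hlt.not_ge (eta_self_nonneg_of_last_eq_zero h0.symm)
  let w : ℝ → Fin (n + 1) → ℝ := fun t => y - t • Pi.single (Fin.last n) 1
  have h1 : Continuous fun t => eta n (F (w t) - F x) (F (w t) - F x) := by
    unfold eta; fun_prop
  have h2 : Continuous fun t => (F (w t) - F x) (Fin.last n) := by fun_prop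
  have hev : ∀ᶠ t in nhds (0 : ℝ), causalLe n x (w t) := by
    filter_upwards [h1.continuousAt.eventually_lt continuousAt_const (by simpa [w] using hlt),
      continuousAt_const.eventually_lt h2.continuousAt
        (by simpa only [w, zero_smul, sub_zero] using hpos)] with t ht1 ht2
    exact (hc _ _).mpr ((causalLe_iff _ _).mpr ⟨ht1.le, ht2.le⟩)
  obtain ⟨δ, hδ, hball⟩ := Metric.eventually_nhds_iff.mp hev
  have hv0 := ((causalLe_iff _ _).mp hxy).2
  have key : ∀ t, 0 < t → t < δ → 2 * (y - x) (Fin.last n) ≤ t ∧ t ≤ (y - x) (Fin.last n) := by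
    intro t ht htδ
    have := (causalLe_iff _ _).mp (hball (y := t) (by simpa [abs_of_pos ht] using htδ))
    have hsub : w t - x = (y - x) - t • Pi.single (Fin.last n) 1 := by simp only [w]; abel
    have he : eta n (y - x) (Pi.single (Fin.last n) 1) = - (y - x) (Fin.last n) := by
      simp [eta, eps, Pi.single_apply]
    have he' := eta_single_single (Fin.last n) (Fin.last n)
    rw [if_pos rfl, eps_last] at he'
    rw [hsub] at this
    rw [eta_sub_left, eta_sub_right (y - x) (y - x), eta_sub_right (t • _) (y - x), h,
      eta_smul_left, eta_smul_left, eta_smul_right, eta_smul_right, he', eta_comm _ (y - x),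
      he] at this
    exact ⟨le_of_mul_le_mul_left (by linarith [this.1]) ht, by simpa using this.2⟩
  have := key (δ / 2) (by linarith) (by linarith)
  linarith [this.1, this.2]

lemma causalLe_or_causalLe {x y : Fin (n + 1) → ℝ} (h : eta n (y - x) (y - x) ≤ 0) :
    causalLe n x y ∨ causalLe n y x := by
  rcases le_total (x (Fin.last n)) (y (Fin.last n)) with h' | h'
  · exact Or.inl ⟨h, h'⟩
  · exact Or.inr ⟨by rwa [← neg_sub y x, eta_neg_neg], h'⟩

lemma eta_map_sub_eq_zero {F : (Fin (n + 1) → ℝ) → (Fin (n + 1) → ℝ)}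
    (hF : Continuous F) (hc : ∀ x y, causalLe n x y ↔ causalLe n (F x) (F y))
    {x y : Fin (n + 1) → ℝ} (h : eta n (y - x) (y - x) = 0) :
    eta n (F y - F x) (F y - F x) = 0 := by
  rcases causalLe_or_causalLe h.le with h' | h'
  · exact eta_map_sub_eq_zero_of_causalLe hF hc h' h
  · rw [← neg_sub, eta_neg_neg]
    exact eta_map_sub_eq_zero_of_causalLe hF hc h' (by rwa [← neg_sub y x, eta_neg_neg])

/-- A surjection preserving null separation in both directions maps the null line through `x`
with direction `v` onto the null line through `F x` and `F (x + v)`. -/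
lemma exists_map_add_smul_eq {F : (Fin (n + 1) → ℝ) → (Fin (n + 1) → ℝ)}
    (hs : Function.Surjective F)
    (hN : ∀ x y, eta n (y - x) (y - x) = 0 ↔ eta n (F y - F x) (F y - F x) = 0)
    {v : Fin (n + 1) → ℝ} (hv : eta n v v = 0) (hv0 : v ≠ 0) (x : Fin (n + 1) → ℝ) (r : ℝ) :
    ∃ t : ℝ, F (x + t • v) = F x + r • (F (x + v) - F x) := by
  have hk : eta n (F (x + v) - F x) (F (x + v) - F x) = 0 := (hN _ _).mp (by simpa using hv)
  obtain ⟨y, hy⟩ := hs (F x + r • (F (x + v) - F x))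
  have h1 : eta n (y - x) (y - x) = 0 := (hN _ _).mpr (by
    rw [hy, add_sub_cancel_left, eta_smul_left, eta_smul_right, hk]; simp)
  have h2 : eta n (y - (x + v)) (y - (x + v)) = 0 := (hN _ _).mpr (by
    rw [hy, show F x + r • (F (x + v) - F x) - F (x + v) = (r - 1) • (F (x + v) - F x) by
      module, eta_smul_left, eta_smul_right, hk]; simp)
  have h3 : eta n v (y - x) = 0 := by
    rw [← sub_sub, eta_sub_left, eta_sub_right (y - x), eta_sub_right v, h1, hv,
      eta_comm (y - x)] at h2
    linarith
  obtain ⟨t, ht⟩ := exists_smul_of_null hv h1 h3 hv0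
  exact ⟨t, by rw [← ht, add_sub_cancel, hy]⟩

/-- A bijection preserving null separation maps null parallelograms to parallelograms. -/
lemma map_add_add_sub {F : (Fin (n + 1) → ℝ) → (Fin (n + 1) → ℝ)}
    (hb : Function.Bijective F)
    (hN : ∀ x y, eta n (y - x) (y - x) = 0 ↔ eta n (F y - F x) (F y - F x) = 0)
    {u v : Fin (n + 1) → ℝ} (hu : eta n u u = 0) (hv : eta n v v = 0) (huv : eta n u v ≠ 0)
    (x : Fin (n + 1) → ℝ) : F (x + u + v) - F (x + u) = F (x + v) - F x := by
  have hv0 : v ≠ 0 := fun h => huv (by simp [h, eta])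
  set k := F (x + v) - F x with hk
  set K := F (x + u + v) - F (x + u) with hK
  set d := F (x + u) - F x with hd
  have hkk : eta n k k = 0 := (hN _ _).mp (by simpa using hv)
  have hKK : eta n K K = 0 := (hN _ _).mp (by simpa using hv)
  have hdd : eta n d d = 0 := (hN _ _).mp (by simpa using hu)
  have hk0 : k ≠ 0 := fun h => hv0 (by simpa using hb.1 (sub_eq_zero.mp h))
  have hK0 : K ≠ 0 := fun h => hv0 (by simpa using hb.1 (sub_eq_zero.mp h))
  have hc : eta n d k ≠ 0 := by
    intro h0
    have h1 : eta n (F (x + u) - F (x + v)) (F (x + u) - F (x + v)) = 0 := by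
      rw [show F (x + u) - F (x + v) = d - k by rw [hd, hk]; abel, eta_sub_left,
        eta_sub_right d, eta_sub_right k, hdd, hkk, eta_comm k, h0]; simp
    rw [← hN, add_sub_add_left_eq_sub, eta_sub_left, eta_sub_right u, eta_sub_right v, hu, hv,
      eta_comm v] at h1
    exact huv (by linarith)
  have hb0 : eta n d K ≠ 0 := by
    intro h0
    have h1 : eta n (F (x + u + v) - F x) (F (x + u + v) - F x) = 0 := by
      rw [show F (x + u + v) - F x = d + K by rw [hd, hK]; abel, eta_add_left,
        eta_add_right d, eta_add_right K, hdd, hKK, eta_comm K, h0]; simp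
    rw [← hN, add_assoc, add_sub_cancel_left, eta_add_left, eta_add_right u, eta_add_right v, hu,
      hv, eta_comm v] at h1
    exact huv (by linarith)
  have hrel : ∀ t h : ℝ, F (x + t • v) = F x + h • k → ∃ H : ℝ,
      H * eta n d K - h * eta n d k = H * h * eta n k K := by
    intro t h ht
    have h1 : eta n (F (x + u + t • v) - F (x + u)) (F (x + u + t • v) - F (x + u)) = 0 :=
      (hN _ _).mp (by simp [eta_smul_left, eta_smul_right, hv])
    have h2 : eta n (F (x + u + t • v) - F (x + u + v)) (F (x + u + t • v) - F (x + u + v)) = 0 :=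
      (hN _ _).mp (by
        rw [show x + u + t • v - (x + u + v) = (t - 1) • v by module]
        simp [eta_smul_left, eta_smul_right, hv])
    have h3 : eta n K (F (x + u + t • v) - F (x + u)) = 0 := by
      rw [show F (x + u + t • v) - F (x + u + v) = (F (x + u + t • v) - F (x + u)) - K by
        rw [hK]; abel, eta_sub_left, eta_sub_right _ _ K, eta_sub_right K _ K, h1, hKK,
        eta_comm _ K] at h2
      linarith
    obtain ⟨H, hH⟩ := exists_smul_of_null hKK h1 h3 hK0
    have h4 : eta n (F (x + u + t • v) - F (x + t • v)) (F (x + u + t • v) - F (x + t • v)) = 0 :=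
      (hN _ _).mp (by rw [show x + u + t • v - (x + t • v) = u by module, hu])
    rw [ht, show F (x + u + t • v) - (F x + h • k) = d + H • K - h • k by rw [← hH, hd]; abel] at h4
    simp only [eta_sub_left, eta_sub_right _ _ (h • k), eta_add_left, eta_add_right _ d,
      eta_smul_left, eta_smul_right, hdd, hkk, hKK, eta_comm K d, eta_comm k d, eta_comm K k] at h4
    exact ⟨H, by linarith⟩
  have he : eta n k K = 0 := by
    by_contra he
    obtain ⟨t, ht⟩ := exists_map_add_smul_eq hb.2 hN hv hv0 x (eta n d K / eta n k K)
    obtain ⟨H, hH⟩ := hrel t _ ht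
    field_simp at hH
    exact hc (by linarith)
  obtain ⟨r, hr⟩ := exists_smul_of_null hkk hKK he hk0
  have hbc : eta n d K = eta n d k := by
    have h4 : eta n (F (x + u + v) - F (x + v)) (F (x + u + v) - F (x + v)) = 0 :=
      (hN _ _).mp (by rw [show x + u + v - (x + v) = u by module, hu])
    rw [show F (x + u + v) - F (x + v) = d + K - k by rw [hd, hK, hk]; abel] at h4
    simp only [eta_sub_left, eta_sub_right _ _ k, eta_add_left, eta_add_right _ d,
      hdd, hkk, hKK, eta_comm K d, eta_comm k d, eta_comm K k, he] at h4
    linarith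
  rw [hr, eta_smul_right] at hbc
  rw [hr, mul_right_cancel₀ hc (hbc.trans (one_mul _).symm), one_smul]

/-- The Jacobian matrix of `F` at `x`. -/
def jac (F : (Fin (n + 1) → ℝ) → (Fin (n + 1) → ℝ)) (x : Fin (n + 1) → ℝ) :
    Matrix (Fin (n + 1)) (Fin (n + 1)) ℝ :=
  LinearMap.toMatrix' (fderiv ℝ F x).toLinearMap

lemma jac_mulVec (F : (Fin (n + 1) → ℝ) → (Fin (n + 1) → ℝ)) (x v : Fin (n + 1) → ℝ) :
    jac F x *ᵥ v = fderiv ℝ F x v :=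
  LinearMap.toMatrix'_mulVec _ _

lemma jac_col (F : (Fin (n + 1) → ℝ) → (Fin (n + 1) → ℝ)) (x : Fin (n + 1) → ℝ)
    (i : Fin (n + 1)) : (jac F x).col i = fderiv ℝ F x (Pi.single i 1) := by
  rw [← jac_mulVec, mulVec_single_one]

lemma fderiv_leftInverse {F G : (Fin (n + 1) → ℝ) → (Fin (n + 1) → ℝ)}
    (hF : Differentiable ℝ F) (hG : Differentiable ℝ G) (hGF : Function.LeftInverse G F)
    (x : Fin (n + 1) → ℝ) :
    (fderiv ℝ G (F x)).comp (fderiv ℝ F x) = ContinuousLinearMap.id ℝ _ := by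
  rw [← fderiv_comp x (hG _) (hF x), hGF.comp_eq_id, fderiv_id]

lemma jac_mul_jac {F G : (Fin (n + 1) → ℝ) → (Fin (n + 1) → ℝ)}
    (hF : Differentiable ℝ F) (hG : Differentiable ℝ G) (hGF : Function.LeftInverse G F)
    (x : Fin (n + 1) → ℝ) : jac G (F x) * jac F x = 1 := by
  rw [jac, jac, ← LinearMap.toMatrix'_comp, ← ContinuousLinearMap.toLinearMap_comp,
    fderiv_leftInverse hF hG hGF]
  exact LinearMap.toMatrix'_id

lemma ne_zero_of_mul_etaM_mul {J K : Matrix (Fin (n + 1)) (Fin (n + 1)) ℝ} {c : ℝ}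
    (hKJ : K * J = 1) (h : J * etaM n * Jᵀ = c • etaM n) : c ≠ 0 := by
  rintro rfl
  have h1 : K * (J * etaM n * Jᵀ) * Kᵀ = etaM n := by
    rw [← Matrix.mul_assoc, ← Matrix.mul_assoc, hKJ, Matrix.one_mul, Matrix.mul_assoc,
      ← transpose_mul, hKJ, transpose_one, Matrix.mul_one]
  rw [h, zero_smul, Matrix.mul_zero, Matrix.zero_mul] at h1
  have := congrFun (congrFun h1 (Fin.last n)) (Fin.last n)
  rw [etaM_apply, if_pos rfl, eps_last] at this
  norm_num at this

lemma eta_mulVec_mulVec (J : Matrix (Fin (n + 1)) (Fin (n + 1)) ℝ) (u v : Fin (n + 1) → ℝ) :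
    eta n (J *ᵥ u) (J *ᵥ v) = u ⬝ᵥ (Jᵀ * etaM n * J) *ᵥ v := by
  rw [eta_eq_dotProduct, ← mulVec_mulVec, ← mulVec_mulVec, dotProduct_mulVec u, vecMul_transpose]

lemma etaM_transpose : (etaM n)ᵀ = etaM n := diagonal_transpose _

lemma contDiff_fderiv {V : Type*} [NormedAddCommGroup V] [NormedSpace ℝ V]
    {f : (Fin (n + 1) → ℝ) → V} (hf : ContDiff ℝ (⊤ : ℕ∞) f) :
    ContDiff ℝ (⊤ : ℕ∞) (fderiv ℝ f) :=
  hf.fderiv_right (by simp)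

lemma hasFDerivAt_fderiv {V : Type*} [NormedAddCommGroup V] [NormedSpace ℝ V]
    {f : (Fin (n + 1) → ℝ) → V} (hf : ContDiff ℝ (⊤ : ℕ∞) f) (x : Fin (n + 1) → ℝ) :
    HasFDerivAt (fderiv ℝ f) (fderiv ℝ (fderiv ℝ f) x) x :=
  ((contDiff_fderiv hf).differentiable (by simp) x).hasFDerivAt

lemma fderiv_fderiv_symm {V : Type*} [NormedAddCommGroup V] [NormedSpace ℝ V]
    {f : (Fin (n + 1) → ℝ) → V} (hf : ContDiff ℝ (⊤ : ℕ∞) f) (x u v : Fin (n + 1) → ℝ) :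
    fderiv ℝ (fderiv ℝ f) x u v = fderiv ℝ (fderiv ℝ f) x v u :=
  hf.contDiffAt.isSymmSndFDerivAt
    (by simpa using WithTop.coe_le_coe.mpr (le_top (a := (2 : ℕ∞)))) u v

lemma waveOp_eq {f : (Fin (n + 1) → ℝ) → ℝ} (hf : ContDiff ℝ (⊤ : ℕ∞) f)
    (x : Fin (n + 1) → ℝ) :
    waveOp n f x = ∑ i, eps n i *
      fderiv ℝ (fderiv ℝ f) x (Pi.single i 1) (Pi.single i 1) := by
  refine Finset.sum_congr rfl fun i _ => ?_
  have h := ((hasFDerivAt_fderiv hf x).clm_apply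
    (hasFDerivAt_const (Pi.single i (1 : ℝ)) x)).fderiv
  have h' : pd n f i = fun y => fderiv ℝ f y (Pi.single i 1) := rfl
  rw [h', pd, h]
  simp

/-- The wave operator applied componentwise to a vector-valued map. -/
def waveVec (F : (Fin (n + 1) → ℝ) → (Fin (n + 1) → ℝ)) (x : Fin (n + 1) → ℝ) :
    Fin (n + 1) → ℝ :=
  ∑ i, eps n i • fderiv ℝ (fderiv ℝ F) x (Pi.single i 1) (Pi.single i 1)

lemma waveOp_comp {ψ : (Fin (n + 1) → ℝ) → ℝ} {F : (Fin (n + 1) → ℝ) → (Fin (n + 1) → ℝ)}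
    (hψ : ContDiff ℝ (⊤ : ℕ∞) ψ) (hF : ContDiff ℝ (⊤ : ℕ∞) F) (x : Fin (n + 1) → ℝ) :
    waveOp n (ψ ∘ F) x = ∑ a, ∑ b, (jac F x * etaM n * (jac F x)ᵀ) a b *
        fderiv ℝ (fderiv ℝ ψ) (F x) (Pi.single a 1) (Pi.single b 1)
      + fderiv ℝ ψ (F x) (waveVec F x) := by
  have hFx := (hF.differentiable (by simp) x).hasFDerivAt
  have h1 : fderiv ℝ (ψ ∘ F) = fun y => (fderiv ℝ ψ (F y)).comp (fderiv ℝ F y) :=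
    funext fun y => fderiv_comp y (hψ.differentiable (by simp) _) (hF.differentiable (by simp) y)
  have h2 := (((hasFDerivAt_fderiv hψ (F x)).comp x hFx).clm_comp (hasFDerivAt_fderiv hF x)).fderiv
  rw [waveOp_eq (hψ.comp hF), ← sum_eps_apply_mulVec, waveVec, map_sum, ← Finset.sum_add_distrib]
  refine Finset.sum_congr rfl fun i _ => ?_
  rw [h1]
  erw [h2]
  simp [jac_col]
  ring

lemma waveOp_comp_eq_zero {ψ : (Fin (n + 1) → ℝ) → ℝ}
    {F : (Fin (n + 1) → ℝ) → (Fin (n + 1) → ℝ)}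
    (hψ : ContDiff ℝ (⊤ : ℕ∞) ψ) (hF : ContDiff ℝ (⊤ : ℕ∞) F) {x : Fin (n + 1) → ℝ} {c : ℝ}
    (hc : jac F x * etaM n * (jac F x)ᵀ = c • etaM n) (hw : waveVec F x = 0)
    (h : waveOp n ψ (F x) = 0) : waveOp n (ψ ∘ F) x = 0 := by
  rw [waveOp_eq hψ] at h
  rw [waveOp_comp hψ hF, hw, map_zero, add_zero, hc]
  simp_rw [Matrix.smul_apply, etaM_apply, smul_eq_mul, mul_ite, ite_mul, mul_zero, zero_mul,
    Finset.sum_ite_eq, Finset.mem_univ, if_true, mul_assoc, ← Finset.mul_sum, h, mul_zero]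

lemma hasDerivAt_add_smul {V : Type*} [NormedAddCommGroup V] [NormedSpace ℝ V]
    {f : (Fin (n + 1) → ℝ) → V} {x : Fin (n + 1) → ℝ} (hf : DifferentiableAt ℝ f x)
    (v : Fin (n + 1) → ℝ) :
    HasDerivAt (fun t : ℝ => f (x + t • v)) (fderiv ℝ f x v) 0 :=
  hf.hasFDerivAt.hasLineDerivAt v

/-- The differential of a map preserving null separation preserves null vectors. -/
lemma eta_fderiv_eq_zero {F : (Fin (n + 1) → ℝ) → (Fin (n + 1) → ℝ)} (hF : Differentiable ℝ F)
    (hN : ∀ x y, eta n (y - x) (y - x) = 0 ↔ eta n (F y - F x) (F y - F x) = 0)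
    (x : Fin (n + 1) → ℝ) {v : Fin (n + 1) → ℝ} (hv : eta n v v = 0) :
    eta n (fderiv ℝ F x v) (fderiv ℝ F x v) = 0 := by
  have h := (hasDerivAt_add_smul (hF x) v).tendsto_slope_zero
  have hcont : Continuous fun w => eta n w w := by unfold eta; fun_prop
  refine tendsto_nhds_unique ((hcont.tendsto _).comp h) (tendsto_const_nhds.congr fun t => ?_)
  have : eta n (F (x + t • v) - F x) (F (x + t • v) - F x) = 0 :=
    (hN _ _).mp (by simp [eta_smul_left, eta_smul_right, hv])
  simp [eta_smul_left, eta_smul_right, this]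

/-- The second differential of a null-separation preserving bijection vanishes on pairs of
independent null vectors. -/
lemma fderiv_fderiv_eq_zero_of_null {F : (Fin (n + 1) → ℝ) → (Fin (n + 1) → ℝ)}
    (hF : ContDiff ℝ (⊤ : ℕ∞) F) (hb : Function.Bijective F)
    (hN : ∀ x y, eta n (y - x) (y - x) = 0 ↔ eta n (F y - F x) (F y - F x) = 0)
    {u v : Fin (n + 1) → ℝ} (hu : eta n u u = 0) (hv : eta n v v = 0) (huv : eta n u v ≠ 0)
    (x : Fin (n + 1) → ℝ) : fderiv ℝ (fderiv ℝ F) x u v = 0 := by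
  have hd : Differentiable ℝ F := hF.differentiable (by simp)
  have h1 : ∀ s : ℝ, fderiv ℝ F (x + s • u) v = fderiv ℝ F x v := by
    intro s
    by_cases hs : s = 0
    · simp [hs]
    have ha := (hasDerivAt_add_smul (hd (x + s • u)) v).sub_const (F (x + s • u))
    have hb' := (hasDerivAt_add_smul (hd x) v).sub_const (F x)
    refine ha.unique (hb'.congr_of_eventuallyEq (Filter.Eventually.of_forall fun t => ?_))
    by_cases ht : t = 0
    · simp [ht]
    exact map_add_add_sub hb hN (by simp [eta_smul_left, eta_smul_right, hu])
      (by simp [eta_smul_left, eta_smul_right, hv])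
      (by simp [eta_smul_left, eta_smul_right, huv, hs, ht]) x
  have h2 := (hasDerivAt_add_smul (hasFDerivAt_fderiv hF x).differentiableAt u).clm_apply
    (hasDerivAt_const (0 : ℝ) v)
  simp only [h1, map_zero, add_zero] at h2
  exact h2.unique (hasDerivAt_const _ _)

lemma waveVec_eq_zero (hn : 2 ≤ n) {F : (Fin (n + 1) → ℝ) → (Fin (n + 1) → ℝ)}
    (hF : ContDiff ℝ (⊤ : ℕ∞) F) (hb : Function.Bijective F)
    (hN : ∀ x y, eta n (y - x) (y - x) = 0 ↔ eta n (F y - F x) (F y - F x) = 0)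
    (x : Fin (n + 1) → ℝ) : waveVec F x = 0 := by
  set B := fderiv ℝ (fderiv ℝ F) x with hB
  set l := Fin.last n
  have hnull : ∀ i, i ≠ l → ∀ s : ℝ, s * s = 1 → eta n (Pi.single l 1 + s • Pi.single i 1)
      (Pi.single l 1 + s • Pi.single i 1) = 0 := by
    intro i hi s hs
    simp only [eta_add_left, eta_add_right, eta_smul_left, eta_smul_right, eta_single_single,
        if_neg hi, if_neg hi.symm, eps_last, eps_of_ne hi, if_true, l]
    linarith
  have hsame : ∀ i, i ≠ l →
      B (Pi.single i 1) (Pi.single i 1) = B (Pi.single l 1) (Pi.single l 1) := by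
    intro i hi
    have h := fderiv_fderiv_eq_zero_of_null hF hb hN (hnull i hi 1 (by norm_num))
      (hnull i hi (-1) (by norm_num)) (by
        simp only [eta_add_left, eta_add_right, eta_smul_left, eta_smul_right, eta_single_single,
          if_neg hi, if_neg hi.symm, eps_last, eps_of_ne hi, if_true, l]
        norm_num) x
    simp only [← hB, map_add, map_smul, _root_.add_apply, _root_.smul_apply] at h
    have hsymm : B (Pi.single i 1) (Pi.single l 1) = B (Pi.single l 1) (Pi.single i 1) :=
      fderiv_fderiv_symm hF x _ _
    linear_combination (norm := module) (-1 : ℝ) • h + hsymm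
  have hll : B (Pi.single l 1) (Pi.single l 1) = 0 := by
    have hi : (⟨0, by omega⟩ : Fin (n + 1)) ≠ l := by simp [l, Fin.ext_iff]; omega
    have hj : (⟨1, by omega⟩ : Fin (n + 1)) ≠ l := by simp [l, Fin.ext_iff]; omega
    have hij : (⟨0, by omega⟩ : Fin (n + 1)) ≠ ⟨1, by omega⟩ := by simp
    have h : ∀ s t : ℝ, s * s = 1 → t * t = 1 → _ := fun s t hs ht =>
      fderiv_fderiv_eq_zero_of_null hF hb hN (hnull _ hi s hs) (hnull _ hj t ht) (by
        simp only [eta_add_left, eta_add_right, eta_smul_left, eta_smul_right, eta_single_single,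
          if_neg hi, if_neg hj.symm, if_neg hij, eps_last, if_true, l]
        norm_num) x
    simp only [← hB, map_add, map_smul, _root_.add_apply, _root_.smul_apply] at h
    have h1 := h 1 1 (by norm_num) (by norm_num)
    have h2 := h 1 (-1) (by norm_num) (by norm_num)
    have h3 := h (-1) 1 (by norm_num) (by norm_num)
    have h4 := h (-1) (-1) (by norm_num) (by norm_num)
    linear_combination (norm := module) (1 / 4 : ℝ) • (h1 + h2 + h3 + h4)
  refine Finset.sum_eq_zero fun i _ => ?_
  by_cases hi : i = l
  · rw [hi, ← hB, hll, smul_zero]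
  · rw [← hB, hsame i hi, hll, smul_zero]

/-- The inverse of a causal automorphism is a causal automorphism. -/
lemma IsCausalAuto.symm {F G : (Fin (n + 1) → ℝ) → (Fin (n + 1) → ℝ)}
    (h : IsCausalAuto n F) (hGF : Function.LeftInverse G F) (hFG : Function.RightInverse G F) :
    IsCausalAuto n G :=
  ⟨⟨hFG.injective, hGF.surjective⟩, fun x y => by rw [h.2 (G x) (G y), hFG x, hFG y]⟩

/-- A causal automorphism pulls back solutions of the wave equation to solutions. -/
lemma IsCausalAuto.waveOp_comp_eq_zero (hn : 2 ≤ n)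
    {F G : (Fin (n + 1) → ℝ) → (Fin (n + 1) → ℝ)}
    (hF : ContDiff ℝ (⊤ : ℕ∞) F) (hG : ContDiff ℝ (⊤ : ℕ∞) G)
    (hGF : Function.LeftInverse G F) (hFG : Function.RightInverse G F)
    (h : IsCausalAuto n F) {ψ : (Fin (n + 1) → ℝ) → ℝ} (hψ : ContDiff ℝ (⊤ : ℕ∞) ψ)
    (hw : ∀ x, waveOp n ψ x = 0) (x : Fin (n + 1) → ℝ) : waveOp n (ψ ∘ F) x = 0 := by
  have hdF : Differentiable ℝ F := hF.differentiable (by simp)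
  have hdG : Differentiable ℝ G := hG.differentiable (by simp)
  have hN : ∀ x y, eta n (y - x) (y - x) = 0 ↔ eta n (F y - F x) (F y - F x) = 0 :=
    fun x y => ⟨eta_map_sub_eq_zero hdF.continuous h.2, fun h0 => by
      simpa only [hGF x, hGF y] using eta_map_sub_eq_zero hdG.continuous (h.symm hGF hFG).2 h0⟩
  have hJ : (jac F x)ᵀ * etaM n * jac F x = _ :=
    eq_smul_etaM (by simp only [transpose_mul, transpose_transpose, etaM_transpose,
      Matrix.mul_assoc]) fun v hv => by
        rw [← eta_mulVec_mulVec, jac_mulVec, eta_fderiv_eq_zero hdF hN x hv]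
  have hKJ := mul_eq_one_comm.mp (jac_mul_jac hdF hdG hGF x)
  have hc := ne_zero_of_mul_etaM_mul (J := (jac F x)ᵀ) (K := (jac G (F x))ᵀ)
    (by rw [← transpose_mul, hKJ, transpose_one]) (by rwa [transpose_transpose])
  exact _root_.waveOp_comp_eq_zero hψ hF (mul_etaM_mul_transpose hc hJ)
    (waveVec_eq_zero hn hF h.1 hN x) (hw _)

lemma IsCausalAuto.pd_last_nonneg {F : (Fin (n + 1) → ℝ) → (Fin (n + 1) → ℝ)}
    (hF : Differentiable ℝ F) (h : IsCausalAuto n F) (x : Fin (n + 1) → ℝ) :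
    0 ≤ pd n (fun z => F z (Fin.last n)) (Fin.last n) x := by
  have hd : DifferentiableAt ℝ (fun z => F z (Fin.last n)) x := by fun_prop
  refine ge_of_tendsto (hasDerivAt_add_smul hd (Pi.single (Fin.last n) 1)).tendsto_slope_zero_right
    (Filter.mem_of_superset self_mem_nhdsWithin fun t (ht : 0 < t) => ?_)
  have hle : causalLe n x (x + t • Pi.single (Fin.last n) 1) := by
    rw [causalLe_iff, add_sub_cancel_left, eta_smul_left, eta_smul_right, eta_single_single,
      if_pos rfl, eps_last]
    exact ⟨by nlinarith, by simpa using ht.le⟩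
  have := ((h.2 _ _).mp hle).2
  simp only [Set.mem_ofPred_eq, zero_add, zero_smul, add_zero, smul_eq_mul]
  exact mul_nonneg (inv_nonneg.mpr ht.le) (by linarith)

/-- A smooth conformal map of Minkowski space, of dimension at least three, whose components solve
the wave equation is affine. -/
lemma fderiv_fderiv_eq_zero_of_conformal (hn : 2 ≤ n)
    {F : (Fin (n + 1) → ℝ) → (Fin (n + 1) → ℝ)} (hF : ContDiff ℝ (⊤ : ℕ∞) F)
    {c : (Fin (n + 1) → ℝ) → ℝ}
    (hc : ∀ x u v, eta n (fderiv ℝ F x u) (fderiv ℝ F x v) = c x * eta n u v)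
    (hs : ∀ x, Function.Surjective (fderiv ℝ F x)) (hw : ∀ x, waveVec F x = 0)
    (x : Fin (n + 1) → ℝ) : fderiv ℝ (fderiv ℝ F) x = 0 := by
  set B := fderiv ℝ (fderiv ℝ F) x with hB
  have hder : ∀ u v, HasFDerivAt (fun y => eta n (fderiv ℝ F y u) (fderiv ℝ F y v)) _ x :=
    fun u v => (etaCLM n).hasFDerivAt_of_bilinear
      ((hasFDerivAt_fderiv hF x).clm_apply (hasFDerivAt_const u x))
      ((hasFDerivAt_fderiv hF x).clm_apply (hasFDerivAt_const v x))
  have hcd : DifferentiableAt ℝ c x := by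
    have h := (hder (Pi.single (Fin.last n) 1) (Pi.single (Fin.last n) 1)).differentiableAt.neg
    refine h.congr_of_eventuallyEq (Filter.Eventually.of_forall fun y => ?_)
    simp [hc, eta_single_single, eps_last]
  have hT : ∀ w u v, eta n (B w u) (fderiv ℝ F x v) + eta n (fderiv ℝ F x u) (B w v)
      = fderiv ℝ c x w * eta n u v := by
    intro w u v
    have h := hder u v
    simp only [hc] at h
    have h' := congrArg (fun L => L w) (h.unique (hcd.hasFDerivAt.mul_const (eta n u v)))
    simp at h'
    linarith
  have hsymm : ∀ u v, B u v = B v u := fderiv_fderiv_symm hF x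
  have hK : ∀ u v w, 2 * eta n (B u v) (fderiv ℝ F x w) = fderiv ℝ c x u * eta n v w
      + fderiv ℝ c x v * eta n u w - fderiv ℝ c x w * eta n u v := by
    intro u v w
    have h1 := hT u v w
    have h2 := hT v u w
    have h3 := hT w u v
    rw [eta_comm _ (B u w), hsymm u w] at h1
    rw [eta_comm _ (B v w), hsymm v w, hsymm v u] at h2
    rw [eta_comm _ (B w v)] at h3
    linarith
  have hc0 : ∀ k, fderiv ℝ c x (Pi.single k 1) = 0 := by
    intro k
    have h1 : ∑ i, eps n i * (2 * eta n (B (Pi.single i 1) (Pi.single i 1))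
        (fderiv ℝ F x (Pi.single k 1))) = 0 := by
      have := congrArg (fun z => 2 * etaCLM n z (fderiv ℝ F x (Pi.single k 1))) (hw x)
      simp only [waveVec, map_sum, map_smul, _root_.sum_apply, _root_.smul_apply, etaCLM_apply,
        smul_eq_mul, map_zero, _root_.zero_apply, mul_zero, Finset.mul_sum] at this
      rw [← this]
      exact Finset.sum_congr rfl fun i _ => by ring
    have h2 : ∀ i, eps n i * (2 * eta n (B (Pi.single i 1) (Pi.single i 1))
        (fderiv ℝ F x (Pi.single k 1))) = (if i = k then 2 * fderiv ℝ c x (Pi.single k 1) else 0)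
          - fderiv ℝ c x (Pi.single k 1) := by
      intro i
      rw [hK, eta_single_single, eta_single_single, if_pos rfl]
      have := eps_mul_self i
      split_ifs with h
      · subst h; linear_combination (fderiv ℝ c x (Pi.single i 1)) * this
      · linear_combination (- fderiv ℝ c x (Pi.single k 1)) * this
    simp only [h2, Finset.sum_sub_distrib, Finset.sum_ite_eq', Finset.mem_univ, if_true,
      Finset.sum_const, Finset.card_univ, Fintype.card_fin, nsmul_eq_mul] at h1
    have hn' : (2 : ℝ) ≤ n := by exact_mod_cast hn
    push_cast at h1
    have h3 : (1 - (n : ℝ)) * fderiv ℝ c x (Pi.single k 1) = 0 := by linarith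
    exact (mul_eq_zero.mp h3).resolve_left (by linarith)
  have hc' : fderiv ℝ c x = 0 := by
    ext w
    rw [pi_eq_sum_univ' w]
    simp [hc0]
  ext1 u
  ext1 v
  funext i
  obtain ⟨w, hw'⟩ := hs x (Pi.single i 1)
  have h := hK u v w
  rw [hc', hw'] at h
  have h0 : eta n (B u v) (Pi.single i 1) = eps n i * B u v i := by
    simp [eta, Pi.single_apply]
  rw [h0] at h
  simp only [_root_.zero_apply, zero_mul, add_zero, sub_zero] at h
  have := eps_mul_self i
  simp only [_root_.zero_apply, Pi.zero_apply]
  linear_combination (eps n i / 2) * h - B u v i * this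

/-- The continuous linear functional `v ↦ ∑ i, l i * v i`. -/
def dotCLM (l : Fin (n + 1) → ℝ) : (Fin (n + 1) → ℝ) →L[ℝ] ℝ :=
  ∑ i, l i • ContinuousLinearMap.proj i

lemma dotCLM_apply (l v : Fin (n + 1) → ℝ) : dotCLM l v = l ⬝ᵥ v := by
  simp [dotCLM, dotProduct, _root_.sum_apply]

lemma fderiv_fderiv_clm (L : (Fin (n + 1) → ℝ) →L[ℝ] ℝ) (x : Fin (n + 1) → ℝ) :
    fderiv ℝ (fderiv ℝ L) x = 0 := by
  have : fderiv ℝ L = fun _ => L := funext fun y => L.fderiv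
  rw [this]
  simp

lemma fderiv_fderiv_clm_sq (L : (Fin (n + 1) → ℝ) →L[ℝ] ℝ) (x u v : Fin (n + 1) → ℝ) :
    fderiv ℝ (fderiv ℝ fun y => L y * L y) x u v = 2 * L u * L v := by
  have h : fderiv ℝ (fun y => L y * L y) = fun y => (2 * L y) • L := by
    funext y
    rw [(L.hasFDerivAt.fun_mul L.hasFDerivAt).fderiv]
    module
  rw [h, ((L.hasFDerivAt.const_mul 2).smul_const L).fderiv]
  simp

/-- If `F` pulls back solutions of the wave equation to solutions, then so are its components. -/
lemma waveVec_eq_zero_of_waveOp {F : (Fin (n + 1) → ℝ) → (Fin (n + 1) → ℝ)}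
    (hF : ContDiff ℝ (⊤ : ℕ∞) F)
    (h : ∀ ψ : (Fin (n + 1) → ℝ) → ℝ, ContDiff ℝ (⊤ : ℕ∞) ψ → (∀ x, waveOp n ψ x = 0) →
      ∀ x, waveOp n (ψ ∘ F) x = 0) (x : Fin (n + 1) → ℝ) : waveVec F x = 0 := by
  funext i
  let L : (Fin (n + 1) → ℝ) →L[ℝ] ℝ := ContinuousLinearMap.proj i
  have h0 := h L L.contDiff (fun x => by simp [waveOp_eq L.contDiff, fderiv_fderiv_clm]) x
  rw [waveOp_comp L.contDiff hF] at h0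
  simpa [fderiv_fderiv_clm, L] using h0

/-- If `F` pulls back solutions of the wave equation to solutions, then it is conformal. -/
lemma jac_mul_etaM_mul_transpose_of_waveOp {F : (Fin (n + 1) → ℝ) → (Fin (n + 1) → ℝ)}
    (hF : ContDiff ℝ (⊤ : ℕ∞) F)
    (h : ∀ ψ : (Fin (n + 1) → ℝ) → ℝ, ContDiff ℝ (⊤ : ℕ∞) ψ → (∀ x, waveOp n ψ x = 0) →
      ∀ x, waveOp n (ψ ∘ F) x = 0) (x : Fin (n + 1) → ℝ) :
    ∃ c : ℝ, jac F x * etaM n * (jac F x)ᵀ = c • etaM n := by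
  refine ⟨_, eq_smul_etaM (by simp only [transpose_mul, transpose_transpose, etaM_transpose,
      Matrix.mul_assoc]) fun l hl => ?_⟩
  have hψ : ContDiff ℝ (⊤ : ℕ∞) fun y => dotCLM l y * dotCLM l y :=
    (dotCLM l).contDiff.mul (dotCLM l).contDiff
  have h0 := h _ hψ (fun y => by
    rw [waveOp_eq hψ]
    simp only [fderiv_fderiv_clm_sq]
    simp only [dotCLM_apply, dotProduct_single_one]
    rw [eta] at hl
    rw [← mul_zero (2 : ℝ), ← hl, Finset.mul_sum]
    exact Finset.sum_congr rfl fun i _ => by ring) x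
  rw [waveOp_comp hψ hF, waveVec_eq_zero_of_waveOp hF h, map_zero, add_zero] at h0
  simp only [fderiv_fderiv_clm_sq] at h0
  simp only [dotCLM_apply, dotProduct_single_one] at h0
  have h1 : 2 * (l ⬝ᵥ (jac F x * etaM n * (jac F x)ᵀ) *ᵥ l) = 0 := by
    rw [← h0]
    simp only [dotProduct, mulVec, Finset.mul_sum]
    exact Finset.sum_congr rfl fun i _ => Finset.sum_congr rfl fun j _ => by ring
  linarith

/-- In dimension at least three the conformal factor of a conformal matrix is positive. -/
lemma pos_of_eta_mulVec (hn : 2 ≤ n) {A : (Fin (n + 1) → ℝ) →L[ℝ] (Fin (n + 1) → ℝ)} {c : ℝ}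
    (hc : c ≠ 0) (hA : ∀ u v, eta n (A u) (A v) = c * eta n u v) : 0 < c := by
  refine lt_of_le_of_ne (not_lt.mp fun hneg => ?_) hc.symm
  set i : Fin (n + 1) := ⟨0, by omega⟩
  set j : Fin (n + 1) := ⟨1, by omega⟩
  have hi : i ≠ Fin.last n := by simp [i, Fin.ext_iff]; omega
  have hj : j ≠ Fin.last n := by simp [j, Fin.ext_iff]; omega
  have hij : i ≠ j := by simp [i, j]
  set p := A (Pi.single i 1) (Fin.last n) with hp
  set q := A (Pi.single j 1) (Fin.last n) with hq
  have h1 := eta_self_nonneg_of_last_eq_zero (n := n)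
    (u := A (q • Pi.single i 1 - p • Pi.single j 1)) (by simp [← hp, ← hq]; ring)
  rw [hA] at h1
  simp only [eta_sub_left, eta_sub_right _ _ (p • _), eta_smul_left, eta_smul_right,
    eta_single_single, if_neg hij, if_neg hij.symm, if_true, eps_of_ne hi, eps_of_ne hj] at h1
  have hp0 : p = 0 := by
    by_contra hp0
    have : 0 < p ^ 2 := by positivity
    nlinarith [sq_nonneg q]
  have h2 := eta_self_nonneg_of_last_eq_zero (u := A (Pi.single i 1)) (hp ▸ hp0)
  rw [hA, eta_single_single, if_pos rfl, eps_of_ne hi] at h2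
  linarith

end

/-- **Characterization of causal automorphisms by wave equations.** A smooth diffeomorphism
`F` of `ℝ^{n+1}` (with `n ≥ 2`) is a causal automorphism of Minkowski spacetime if and only
if `∂y_{n+1}/∂x_{n+1} ≥ 0` everywhere and `F` transforms solutions of the wave equation
exactly to solutions of the wave equation. -/
theorem causal_auto_iff_wave_preserving (n : ℕ) (hn : 2 ≤ n)
    (F G : (Fin (n + 1) → ℝ) → (Fin (n + 1) → ℝ))
    (hF : ContDiff ℝ (⊤ : ℕ∞) F) (hG : ContDiff ℝ (⊤ : ℕ∞) G)
    (hGF : Function.LeftInverse G F) (hFG : Function.RightInverse G F) :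
    IsCausalAuto n F ↔
      ((∀ x, 0 ≤ pd n (fun z => F z (Fin.last n)) (Fin.last n) x) ∧
       (∀ ψ : (Fin (n + 1) → ℝ) → ℝ, ContDiff ℝ (⊤ : ℕ∞) ψ →
        ((∀ x, waveOp n (ψ ∘ F) x = 0) ↔ (∀ x, waveOp n ψ x = 0)))) := by
  have hdF : Differentiable ℝ F := hF.differentiable (by simp)
  have hdG : Differentiable ℝ G := hG.differentiable (by simp)
  constructor
  · intro h
    refine ⟨h.pd_last_nonneg hdF, fun ψ hψ => ⟨fun hw => ?_,
      h.waveOp_comp_eq_zero hn hF hG hGF hFG hψ⟩⟩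
    have := (h.symm hGF hFG).waveOp_comp_eq_zero hn hG hF hFG hGF (hψ.comp hF) hw
    rwa [Function.comp_assoc, hFG.comp_eq_id, Function.comp_id] at this
  · rintro ⟨hpos, hwave⟩
    have h : ∀ ψ : (Fin (n + 1) → ℝ) → ℝ, ContDiff ℝ (⊤ : ℕ∞) ψ → (∀ x, waveOp n ψ x = 0) →
      ∀ x, waveOp n (ψ ∘ F) x = 0 := fun ψ hψ => (hwave ψ hψ).mpr
    choose c hc using jac_mul_etaM_mul_transpose_of_waveOp hF h
    have hKJ := fun x => jac_mul_jac hdF hdG hGF x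
    have hc0 : ∀ x, c x ≠ 0 := fun x => ne_zero_of_mul_etaM_mul (hKJ x) (hc x)
    have hconf : ∀ x u v, eta n (fderiv ℝ F x u) (fderiv ℝ F x v) = c x * eta n u v := by
      intro x u v
      have := mul_etaM_mul_transpose (J := (jac F x)ᵀ) (hc0 x) (by rw [transpose_transpose, hc x])
      rw [transpose_transpose] at this
      rw [← jac_mulVec, ← jac_mulVec, eta_mulVec_mulVec, this, smul_mulVec, dotProduct_smul,
        ← eta_eq_dotProduct, smul_eq_mul]
    have hs : ∀ x, Function.Surjective (fderiv ℝ F x) := fun x z =>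
      ⟨jac G (F x) *ᵥ z, by
        rw [← jac_mulVec, mulVec_mulVec, mul_eq_one_comm.mp (hKJ x), one_mulVec]⟩
    set A := fderiv ℝ F 0 with hA
    have hconst : ∀ x, fderiv ℝ F x = A := fun x =>
      is_const_of_fderiv_eq_zero ((contDiff_fderiv hF).differentiable (by simp))
        (fderiv_fderiv_eq_zero_of_conformal hn hF hconf hs (waveVec_eq_zero_of_waveOp hF h)) x 0
    have haff : ∀ x y, F y - F x = A (y - x) := by
      intro x y
      have hd : Differentiable ℝ fun z => F z - A z := hdF.sub A.differentiable
      have := is_const_of_fderiv_eq_zero hd (fun z => by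
        rw [fderiv_fun_sub (hdF z) A.differentiableAt, hconst, A.fderiv, sub_self]) y x
      rw [map_sub]
      linear_combination this
    have hcpos : 0 < c 0 := pos_of_eta_mulVec hn (hc0 0) (hconf 0)
    set r : Fin (n + 1) → ℝ := (jac F 0) (Fin.last n) with hr
    have hrv : ∀ v, A v (Fin.last n) = r ⬝ᵥ v := fun v => by rw [hA, ← jac_mulVec]; rfl
    have hrr : eta n r r < 0 := by
      have := congrFun (congrFun (hc 0) (Fin.last n)) (Fin.last n)
      rw [Matrix.smul_apply, etaM_apply, if_pos rfl, eps_last, smul_eq_mul] at this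
      have h1 : eta n r r = (jac F 0 * etaM n * (jac F 0)ᵀ) (Fin.last n) (Fin.last n) := by
        simp only [eta, etaM, mul_apply (M := _ * _), mul_diagonal, transpose_apply, hr]
        exact Finset.sum_congr rfl fun i _ => by ring
      rw [h1, this]
      linarith
    have hr0 : 0 ≤ r (Fin.last n) := by
      have h1 := hpos 0
      have h2 : HasFDerivAt (fun z => F z (Fin.last n))
          ((ContinuousLinearMap.proj (Fin.last n)).comp A) 0 :=
        (hasFDerivAt_pi'.mp (hdF 0).hasFDerivAt) (Fin.last n)
      rw [pd, h2.fderiv, ContinuousLinearMap.comp_apply, ContinuousLinearMap.proj_apply, hrv,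
        dotProduct_single_one] at h1
      exact h1
    have hlast : ∀ v, eta n v v ≤ 0 → (0 ≤ v (Fin.last n) ↔ 0 ≤ A v (Fin.last n)) := by
      intro v hv
      rw [hrv]
      rcases lt_trichotomy (v (Fin.last n)) 0 with hv0 | hv0 | hv0
      · have := dotProduct_pos hrr hr0 (v := -v) (by rwa [eta_neg_neg]) (by simpa using hv0)
        rw [dotProduct_neg] at this
        exact iff_of_false hv0.not_ge (by linarith)
      · simp [eq_zero_of_eta_self_nonpos hv hv0]
      · exact iff_of_true hv0.le (dotProduct_pos hrr hr0 hv hv0).le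
    refine ⟨⟨hGF.injective, hFG.surjective⟩, fun x y => ?_⟩
    rw [causalLe_iff, causalLe_iff, haff, hconf, ← not_lt, ← not_lt (a := (0 : ℝ)),
      mul_pos_iff_of_pos_left hcpos, not_lt]
    exact and_congr_right (hlast _)
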